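/- arXiv:1907.01194 — 11 statements merged into one kernel-verified Lean document; each statement's English description precedes it below -/
import Mathlib

section
/- Let M be a real number with 0 ≤ M < F that is not an integer. Then for every u ∈ 𝓜 one has uᵀΓ²u > M², i.e. Σ_{l=−F}^{F} l²‖u_l‖² > M². -/
open scoped RealInnerProductSpace

/-- For a non-integer `M` with `0 ≤ M < F`, every `u ∈ 𝓜`
(unit mass, magnetization `M`) satisfies `uᵀΓ²u > M²`, i.e.
`Σ_{l=-F}^{F} l² ‖u_l‖² > M²`. -/
theorem spinF_gamma2_gt_M_sq
    (F n : ℕ) (hF : 1 ≤ F) (hn : 1 ≤ n) (M : ℝ)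
    (hM0 : 0 ≤ M) (hMF : M < (F : ℝ)) (hMint : ∀ k : ℤ, M ≠ (k : ℝ))
    (u : ℤ → EuclideanSpace ℝ (Fin (2 * n)))
    (hsupp : ∀ l : ℤ, l ∉ Finset.Icc (-(F : ℤ)) (F : ℤ) → u l = 0)
    (hnorm : ∑ l ∈ Finset.Icc (-(F : ℤ)) (F : ℤ), ‖u l‖ ^ 2 = 1)
    (hmag : ∑ l ∈ Finset.Icc (-(F : ℤ)) (F : ℤ), (l : ℝ) * ‖u l‖ ^ 2 = M) :
    M ^ 2 < ∑ l ∈ Finset.Icc (-(F : ℤ)) (F : ℤ), (l : ℝ) ^ 2 * ‖u l‖ ^ 2 := by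
  have hvar : ∑ l ∈ Finset.Icc (-(F : ℤ)) (F : ℤ), ((l : ℝ) - M) ^ 2 * ‖u l‖ ^ 2
      = ∑ l ∈ Finset.Icc (-(F : ℤ)) (F : ℤ), (l : ℝ) ^ 2 * ‖u l‖ ^ 2 - M ^ 2 := by
    have hexpand : ∀ l : ℤ, ((l : ℝ) - M) ^ 2 * ‖u l‖ ^ 2
        = (l : ℝ) ^ 2 * ‖u l‖ ^ 2 - 2 * M * ((l : ℝ) * ‖u l‖ ^ 2) + M ^ 2 * ‖u l‖ ^ 2 :=
      fun l => by ring
    simp only [hexpand, Finset.sum_add_distrib, Finset.sum_sub_distrib, ← Finset.mul_sum,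
      hnorm, hmag]
    ring
  obtain ⟨l, hl, hul⟩ : ∃ l ∈ Finset.Icc (-(F : ℤ)) (F : ℤ), ‖u l‖ ^ 2 ≠ 0 :=
    Finset.exists_ne_zero_of_sum_ne_zero (by rw [hnorm]; exact one_ne_zero)
  have hpos : 0 < ∑ l ∈ Finset.Icc (-(F : ℤ)) (F : ℤ), ((l : ℝ) - M) ^ 2 * ‖u l‖ ^ 2 := by
    refine Finset.sum_pos' (fun _ _ => by positivity) ⟨l, hl, ?_⟩
    have hlM : (l : ℝ) - M ≠ 0 := sub_ne_zero.mpr (hMint l).symm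
    positivity
  linarith
end

section
/- Every w ∈ S belongs to Ω; that is, if wᵀΓ²w − (M+F)·wᵀΓw + MF·wᵀw > 0 and wᵀΓ²w − (M−F)·wᵀΓw − MF·wᵀw > 0, then there exists an index l < M with w_l ≠ 0 and an index l > M with w_l ≠ 0. -/
open scoped RealInnerProductSpace

/-- If the quadratic `(l - a) * (l - b)`, weighted by `‖w l‖ ^ 2`, has positive sum over `s`, then
it is positive at some `l ∈ s` with `w l ≠ 0`. -/
lemma exists_pos_of_quadratic_sum_pos {E : Type*} [NormedAddCommGroup E] (s : Finset ℤ)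
    (w : ℤ → E) (a b : ℝ)
    (h : 0 < ∑ l ∈ s, (l : ℝ) ^ 2 * ‖w l‖ ^ 2 - (a + b) * ∑ l ∈ s, (l : ℝ) * ‖w l‖ ^ 2 +
      a * b * ∑ l ∈ s, ‖w l‖ ^ 2) :
    ∃ l ∈ s, 0 < ((l : ℝ) - a) * (l - b) ∧ w l ≠ 0 := by
  have hsum : 0 < ∑ l ∈ s, ((l : ℝ) - a) * (l - b) * ‖w l‖ ^ 2 := by
    rw [Finset.mul_sum, Finset.mul_sum, ← Finset.sum_sub_distrib, ← Finset.sum_add_distrib] at h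
    refine h.trans_eq (Finset.sum_congr rfl fun l _ => ?_)
    ring
  obtain ⟨l, hl, hpos⟩ := Finset.exists_lt_of_sum_lt (Finset.sum_const_zero.trans_lt hsum)
  exact ⟨l, hl, pos_of_mul_pos_left hpos (sq_nonneg _), fun h0 => by simp [h0] at hpos⟩

/-- Every `w ∈ S` belongs to `Ω`: if
`wᵀΓ²w − (M+F)·wᵀΓw + MF·wᵀw > 0` and `wᵀΓ²w − (M−F)·wᵀΓw − MF·wᵀw > 0`,
then there is an index `l < M` with `w_l ≠ 0` and an index `l > M` with
`w_l ≠ 0`. -/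
theorem spinF_S_subset_Omega
    (F n : ℕ) (hF : 1 ≤ F) (hn : 1 ≤ n) (M : ℝ)
    (hM0 : 0 ≤ M) (hMF : M < (F : ℝ))
    (w : ℤ → EuclideanSpace ℝ (Fin (2 * n)))
    (hsupp : ∀ l : ℤ, l ∉ Finset.Icc (-(F : ℤ)) (F : ℤ) → w l = 0)
    (A B C : ℝ)
    (hA : A = ∑ l ∈ Finset.Icc (-(F : ℤ)) (F : ℤ), ‖w l‖ ^ 2)
    (hB : B = ∑ l ∈ Finset.Icc (-(F : ℤ)) (F : ℤ), (l : ℝ) * ‖w l‖ ^ 2)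
    (hC : C = ∑ l ∈ Finset.Icc (-(F : ℤ)) (F : ℤ), (l : ℝ) ^ 2 * ‖w l‖ ^ 2)
    (hS1 : 0 < C - (M + (F : ℝ)) * B + M * (F : ℝ) * A)
    (hS2 : 0 < C - (M - (F : ℝ)) * B - M * (F : ℝ) * A) :
    (∃ l ∈ Finset.Icc (-(F : ℤ)) (F : ℤ), (l : ℝ) < M ∧ w l ≠ 0) ∧
    (∃ l ∈ Finset.Icc (-(F : ℤ)) (F : ℤ), M < (l : ℝ) ∧ w l ≠ 0) := by
  subst hA hB hC
  constructor
  · obtain ⟨l, hl, hpos, hw⟩ := exists_pos_of_quadratic_sum_pos _ w M F hS1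
    have hlF : (l : ℝ) ≤ F := by exact_mod_cast (Finset.mem_Icc.mp hl).2
    exact ⟨l, hl, by nlinarith, hw⟩
  · obtain ⟨l, hl, hpos, hw⟩ := exists_pos_of_quadratic_sum_pos _ w M (-F) (by linarith)
    have hlF : -(F : ℝ) ≤ l := by exact_mod_cast (Finset.mem_Icc.mp hl).1
    exact ⟨l, hl, by nlinarith, hw⟩
end

section
/- Let w ∈ Ω and write f₁ = f₁(w), f₂ = f₂(w), so f₁ < M < f₂. Define h₁(t) = Σ_{l=f₁}^{f₂} (l − M)‖w_l‖² / (1 − (l − M)t)² for t ∈ (1/(f₁ − M), 1/(f₂ − M)). Then h₁ is strictly increasing on this open interval (its derivative h₁′(t) = Σ_{l=f₁}^{f₂} 2(l − M)²‖w_l‖² / (1 − (l − M)t)³ is positive there), h₁(t) → −∞ as t → 1/(f₁ − M) from the right, h₁(t) → +∞ as t → 1/(f₂ − M) from the left, and consequently h₁ has exactly one zero in (1/(f₁ − M), 1/(f₂ − M)). -/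
open scoped RealInnerProductSpace

/-- A point of the interval between the reciprocals of `a₁ < 0 < a₂` keeps `1 - a * t` positive
for every `a` between `a₁` and `a₂`. -/
theorem one_sub_mul_pos_of_mem_Ioo_one_div {a₁ a₂ a t : ℝ} (ha₁ : a₁ < 0) (ha₂ : 0 < a₂)
    (h₁ : a₁ ≤ a) (h₂ : a ≤ a₂) (ht : t ∈ Set.Ioo (1 / a₁) (1 / a₂)) : 0 < 1 - a * t := by
  have h₁t : a₁ * t < 1 := by
    have := (div_lt_iff_of_neg ha₁).1 ht.1
    linarith
  have h₂t : a₂ * t < 1 := by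
    have := (lt_div_iff₀ ha₂).1 ht.2
    linarith
  rcases le_total 0 t with h | h
  · nlinarith [mul_le_mul_of_nonneg_right h₂ h]
  · nlinarith [mul_le_mul_of_nonpos_right h₁ h]

theorem hasDerivAt_mul_div_one_sub_mul_sq (a c : ℝ) {t : ℝ} (ht : 1 - a * t ≠ 0) :
    HasDerivAt (fun x => a * c / (1 - a * x) ^ 2) (2 * a ^ 2 * c / (1 - a * t) ^ 3) t := by
  have hlin : HasDerivAt (fun x : ℝ => 1 - a * x) (-a) t := by
    simpa using ((hasDerivAt_id t).const_mul a).const_sub 1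
  refine ((hasDerivAt_const t (a * c)).fun_div (hlin.fun_pow 2) (pow_ne_zero 2 ht)).congr_deriv ?_
  rw [div_eq_div_iff (pow_ne_zero 2 (pow_ne_zero 2 ht)) (pow_ne_zero 3 ht)]
  push_cast
  ring

theorem tendsto_inv_one_sub_mul_sq_atTop {a : ℝ} (ha : a ≠ 0) :
    Filter.Tendsto (fun t => ((1 - a * t) ^ 2)⁻¹) (nhdsWithin (1 / a) {1 / a}ᶜ)
      Filter.atTop := by
  refine Filter.Tendsto.inv_tendsto_nhdsGT_zero (tendsto_nhdsWithin_iff.2 ⟨?_, ?_⟩)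
  · have hcont : Continuous fun t : ℝ => (1 - a * t) ^ 2 := by fun_prop
    have := hcont.tendsto (1 / a)
    rw [mul_one_div_cancel ha, sub_self, zero_pow two_ne_zero] at this
    exact this.mono_left nhdsWithin_le_nhds
  · filter_upwards [self_mem_nhdsWithin] with t ht
    have : 1 - a * t ≠ 0 := fun h => ht (by
      rw [Set.mem_singleton_iff, eq_div_iff ha]
      linarith)
    exact Set.mem_Ioi.2 (by positivity)

section PoleSum

variable {ι : Type*} {s : Finset ι} {a c : ι → ℝ} {i : ι}

/-- Away from the pole `1 / a i`, the remaining summands stay bounded near it. -/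
theorem exists_tendsto_sum_erase_mul_div_one_sub_mul_sq [DecidableEq ι] (hai : a i ≠ 0)
    (hne : ∀ j ∈ s, j ≠ i → a j ≠ a i) :
    ∃ r, Filter.Tendsto (fun t => ∑ j ∈ s.erase i, a j * c j / (1 - a j * t) ^ 2)
      (nhdsWithin (1 / a i) {1 / a i}ᶜ) (nhds r) := by
  have hcont : ContinuousAt (fun t => ∑ j ∈ s.erase i, a j * c j / (1 - a j * t) ^ 2)
      (1 / a i) := by
    refine tendsto_finsetSum _ fun j hj => ?_
    have hj' : 1 - a j * (1 / a i) ≠ 0 := by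
      intro h
      refine hne j (Finset.mem_of_mem_erase hj) (Finset.ne_of_mem_erase hj) ?_
      field_simp at h
      linarith
    exact (hasDerivAt_mul_div_one_sub_mul_sq (a j) (c j) hj').continuousAt
  exact ⟨_, hcont.tendsto.mono_left nhdsWithin_le_nhds⟩

theorem tendsto_sum_mul_div_one_sub_mul_sq_atTop (hi : i ∈ s) (hai : 0 < a i) (hci : 0 < c i)
    (hne : ∀ j ∈ s, j ≠ i → a j ≠ a i) :
    Filter.Tendsto (fun t => ∑ j ∈ s, a j * c j / (1 - a j * t) ^ 2)
      (nhdsWithin (1 / a i) {1 / a i}ᶜ) Filter.atTop := by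
  classical
  obtain ⟨r, hr⟩ := exists_tendsto_sum_erase_mul_div_one_sub_mul_sq (c := c) hai.ne' hne
  simp only [← Finset.add_sum_erase s _ hi]
  exact ((tendsto_inv_one_sub_mul_sq_atTop hai.ne').const_mul_atTop
    (mul_pos hai hci)).atTop_add hr

theorem tendsto_sum_mul_div_one_sub_mul_sq_atBot (hi : i ∈ s) (hai : a i < 0) (hci : 0 < c i)
    (hne : ∀ j ∈ s, j ≠ i → a j ≠ a i) :
    Filter.Tendsto (fun t => ∑ j ∈ s, a j * c j / (1 - a j * t) ^ 2)
      (nhdsWithin (1 / a i) {1 / a i}ᶜ) Filter.atBot := by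
  classical
  obtain ⟨r, hr⟩ := exists_tendsto_sum_erase_mul_div_one_sub_mul_sq (c := c) hai.ne hne
  simp only [← Finset.add_sum_erase s _ hi]
  exact ((tendsto_inv_one_sub_mul_sq_atTop hai.ne).const_mul_atTop_of_neg
    (mul_neg_of_neg_of_pos hai hci)).atBot_add hr

end PoleSum

/-- For `w ∈ Ω` with `f₁ = f₁(w) < M < f₂ = f₂(w)`, the function
`h₁(t) = Σ_{l=f₁}^{f₂} (l−M)‖w_l‖²/(1−(l−M)t)²` is strictly increasing on
`(1/(f₁−M), 1/(f₂−M))` with positive derivative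
`h₁′(t) = Σ 2(l−M)²‖w_l‖²/(1−(l−M)t)³`, tends to `−∞` at the left endpoint and
to `+∞` at the right endpoint, and has exactly one zero in this interval. -/
theorem spinF_h1_unique_zero
    (F n : ℕ) (hF : 1 ≤ F) (hn : 1 ≤ n) (M : ℝ)
    (hM0 : 0 ≤ M) (hMF : M < (F : ℝ))
    (w : ℤ → EuclideanSpace ℝ (Fin (2 * n)))
    (hsupp : ∀ l : ℤ, l ∉ Finset.Icc (-(F : ℤ)) (F : ℤ) → w l = 0)
    -- `w ∈ Ω`
    (hΩ1 : ∃ l : ℤ, (l : ℝ) < M ∧ w l ≠ 0)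
    (hΩ2 : ∃ l : ℤ, M < (l : ℝ) ∧ w l ≠ 0)
    -- `f₁ = min{l : w_l ≠ 0}`, `f₂ = max{l : w_l ≠ 0}`
    (f₁ f₂ : ℤ) (hwf₁ : w f₁ ≠ 0) (hwf₂ : w f₂ ≠ 0)
    (hminmax : ∀ l : ℤ, w l ≠ 0 → f₁ ≤ l ∧ l ≤ f₂)
    (h₁ : ℝ → ℝ)
    (hh₁ : ∀ t : ℝ, h₁ t = ∑ l ∈ Finset.Icc f₁ f₂,
        ((l : ℝ) - M) * ‖w l‖ ^ 2 / (1 - ((l : ℝ) - M) * t) ^ 2) :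
    StrictMonoOn h₁ (Set.Ioo (1 / ((f₁ : ℝ) - M)) (1 / ((f₂ : ℝ) - M))) ∧
    (∀ t ∈ Set.Ioo (1 / ((f₁ : ℝ) - M)) (1 / ((f₂ : ℝ) - M)),
      HasDerivAt h₁ (∑ l ∈ Finset.Icc f₁ f₂,
          2 * ((l : ℝ) - M) ^ 2 * ‖w l‖ ^ 2 / (1 - ((l : ℝ) - M) * t) ^ 3) t ∧
      0 < ∑ l ∈ Finset.Icc f₁ f₂,
          2 * ((l : ℝ) - M) ^ 2 * ‖w l‖ ^ 2 / (1 - ((l : ℝ) - M) * t) ^ 3) ∧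
    Filter.Tendsto h₁
      (nhdsWithin (1 / ((f₁ : ℝ) - M)) (Set.Ioi (1 / ((f₁ : ℝ) - M)))) Filter.atBot ∧
    Filter.Tendsto h₁
      (nhdsWithin (1 / ((f₂ : ℝ) - M)) (Set.Iio (1 / ((f₂ : ℝ) - M)))) Filter.atTop ∧
    (∃! t : ℝ, t ∈ Set.Ioo (1 / ((f₁ : ℝ) - M)) (1 / ((f₂ : ℝ) - M)) ∧ h₁ t = 0) := by
  have hf₁ : (f₁ : ℝ) - M < 0 := by
    obtain ⟨l, hl, hwl⟩ := hΩ1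
    have : (f₁ : ℝ) ≤ l := by exact_mod_cast (hminmax l hwl).1
    linarith
  have hf₂ : 0 < (f₂ : ℝ) - M := by
    obtain ⟨l, hl, hwl⟩ := hΩ2
    have : (l : ℝ) ≤ f₂ := by exact_mod_cast (hminmax l hwl).2
    linarith
  have hle : f₁ ≤ f₂ := (hminmax f₁ hwf₁).2
  have hfun : h₁ = fun t => ∑ l ∈ Finset.Icc f₁ f₂,
      ((l : ℝ) - M) * ‖w l‖ ^ 2 / (1 - ((l : ℝ) - M) * t) ^ 2 := funext hh₁
  have hpos : ∀ t ∈ Set.Ioo (1 / ((f₁ : ℝ) - M)) (1 / ((f₂ : ℝ) - M)),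
      ∀ l ∈ Finset.Icc f₁ f₂, 0 < 1 - ((l : ℝ) - M) * t := by
    intro t ht l hl
    rw [Finset.mem_Icc] at hl
    have hl₁ : (f₁ : ℝ) ≤ l := by exact_mod_cast hl.1
    have hl₂ : (l : ℝ) ≤ f₂ := by exact_mod_cast hl.2
    exact one_sub_mul_pos_of_mem_Ioo_one_div hf₁ hf₂ (by linarith) (by linarith) ht
  have hderiv : ∀ t ∈ Set.Ioo (1 / ((f₁ : ℝ) - M)) (1 / ((f₂ : ℝ) - M)),
      HasDerivAt h₁ (∑ l ∈ Finset.Icc f₁ f₂,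
          2 * ((l : ℝ) - M) ^ 2 * ‖w l‖ ^ 2 / (1 - ((l : ℝ) - M) * t) ^ 3) t ∧
      0 < ∑ l ∈ Finset.Icc f₁ f₂,
          2 * ((l : ℝ) - M) ^ 2 * ‖w l‖ ^ 2 / (1 - ((l : ℝ) - M) * t) ^ 3 := by
    intro t ht
    constructor
    · rw [hfun]
      exact HasDerivAt.fun_sum fun l hl =>
        hasDerivAt_mul_div_one_sub_mul_sq _ _ (hpos t ht l hl).ne'
    · refine Finset.sum_pos' (fun l hl => ?_) ⟨f₂, Finset.right_mem_Icc.2 hle, ?_⟩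
      · have := hpos t ht l hl
        positivity
      · have := hpos t ht f₂ (Finset.right_mem_Icc.2 hle)
        have := norm_pos_iff.2 hwf₂
        positivity
  have hcont : ContinuousOn h₁ (Set.Ioo (1 / ((f₁ : ℝ) - M)) (1 / ((f₂ : ℝ) - M))) :=
    fun t ht => (hderiv t ht).1.continuousAt.continuousWithinAt
  have hmono : StrictMonoOn h₁ (Set.Ioo (1 / ((f₁ : ℝ) - M)) (1 / ((f₂ : ℝ) - M))) := by
    refine strictMonoOn_of_deriv_pos (convex_Ioo _ _) hcont fun t ht => ?_
    rw [interior_Ioo] at ht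
    rw [(hderiv t ht).1.deriv]
    exact (hderiv t ht).2
  have hne : ∀ k l : ℤ, l ≠ k → (l : ℝ) - M ≠ (k : ℝ) - M := fun k l hlk h =>
    hlk (by exact_mod_cast sub_left_injective h)
  have hbot : Filter.Tendsto h₁
      (nhdsWithin (1 / ((f₁ : ℝ) - M)) (Set.Ioi (1 / ((f₁ : ℝ) - M)))) Filter.atBot := by
    rw [hfun]
    exact (tendsto_sum_mul_div_one_sub_mul_sq_atBot (a := fun l : ℤ => (l : ℝ) - M)
      (c := fun l => ‖w l‖ ^ 2) (Finset.left_mem_Icc.2 hle) hf₁ (pow_pos (norm_pos_iff.2 hwf₁) 2)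
      fun l _ => hne f₁ l).mono_left (nhdsGT_le_nhdsNE _)
  have htop : Filter.Tendsto h₁
      (nhdsWithin (1 / ((f₂ : ℝ) - M)) (Set.Iio (1 / ((f₂ : ℝ) - M)))) Filter.atTop := by
    rw [hfun]
    exact (tendsto_sum_mul_div_one_sub_mul_sq_atTop (a := fun l : ℤ => (l : ℝ) - M)
      (c := fun l => ‖w l‖ ^ 2) (Finset.right_mem_Icc.2 hle) hf₂ (pow_pos (norm_pos_iff.2 hwf₂) 2)
      fun l _ => hne f₂ l).mono_left (nhdsLT_le_nhdsNE _)
  refine ⟨hmono, hderiv, hbot, htop, ?_⟩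
  have hlt : 1 / ((f₁ : ℝ) - M) < 1 / ((f₂ : ℝ) - M) :=
    (one_div_neg.2 hf₁).trans (one_div_pos.2 hf₂)
  obtain ⟨t, ht, hzero⟩ := isPreconnected_Ioo.intermediate_value_Iii
    (Filter.le_principal_iff.2 (Ioo_mem_nhdsGT hlt))
    (Filter.le_principal_iff.2 (Ioo_mem_nhdsLT hlt)) hcont hbot htop (Set.mem_univ 0)
  exact ⟨t, ⟨ht, hzero⟩, fun u hu => hmono.injOn hu.1 ht (hu.2.trans hzero.symm)⟩
end

section
/- Let w ∈ Ω, write f₁ = f₁(w), f₂ = f₂(w), and let r ∈ (1/(f₁ − M), 1/(f₂ − M)) be the unique zero of h₁(t) = Σ_{l=f₁}^{f₂} (l − M)‖w_l‖² / (1 − (l − M)t)². Set s = Σ_{l=f₁}^{f₂} ‖w_l‖² / (1 − (l − M)r)². Then s > 0, 1 − (l − M)r > 0 for every l with f₁ ≤ l ≤ f₂, and the vector z defined blockwise by z_l = w_l / (√s · (1 − (l − M)r)) for f₁ ≤ l ≤ f₂ and z_l = 0 otherwise satisfies zᵀz = 1 and zᵀΓz = M, i.e. z ∈ 𝓜. 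-/
open scoped RealInnerProductSpace

/-- A linear function of `a` that is less than `1` at both ends of an interval is less than `1`
on the whole interval. -/
theorem one_sub_mul_pos_of_mem_Icc {a b c r : ℝ} (ha : a * r < 1) (hb : b * r < 1)
    (hc : c ∈ Set.Icc a b) : 0 < 1 - c * r := by
  rcases le_total 0 r with h | h
  · linarith [mul_le_mul_of_nonneg_right hc.2 h]
  · linarith [mul_le_mul_of_nonpos_right hc.1 h]

/-- For `w ∈ Ω` with `f₁ = f₁(w)`, `f₂ = f₂(w)`, let
`r ∈ (1/(f₁−M), 1/(f₂−M))` be the zero of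
`h₁(t) = Σ_{l=f₁}^{f₂} (l−M)‖w_l‖²/(1−(l−M)t)²` and set
`s = Σ_{l=f₁}^{f₂} ‖w_l‖²/(1−(l−M)r)²`.  Then `s > 0`, `1−(l−M)r > 0` for all
`f₁ ≤ l ≤ f₂`, and the vector `z` with `z_l = w_l/(√s·(1−(l−M)r))` for
`f₁ ≤ l ≤ f₂` and `z_l = 0` otherwise belongs to `𝓜`. -/
theorem spinF_projective_retraction_in_M
    (F n : ℕ) (hF : 1 ≤ F) (hn : 1 ≤ n) (M : ℝ)
    (hM0 : 0 ≤ M) (hMF : M < (F : ℝ))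
    (w : ℤ → EuclideanSpace ℝ (Fin (2 * n)))
    (hsupp : ∀ l : ℤ, l ∉ Finset.Icc (-(F : ℤ)) (F : ℤ) → w l = 0)
    -- `w ∈ Ω`
    (hΩ1 : ∃ l : ℤ, (l : ℝ) < M ∧ w l ≠ 0)
    (hΩ2 : ∃ l : ℤ, M < (l : ℝ) ∧ w l ≠ 0)
    -- `f₁ = min{l : w_l ≠ 0}`, `f₂ = max{l : w_l ≠ 0}`
    (f₁ f₂ : ℤ) (hwf₁ : w f₁ ≠ 0) (hwf₂ : w f₂ ≠ 0)
    (hminmax : ∀ l : ℤ, w l ≠ 0 → f₁ ≤ l ∧ l ≤ f₂)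
    -- `r` is the zero of `h₁` in the interval
    (r : ℝ) (hr : r ∈ Set.Ioo (1 / ((f₁ : ℝ) - M)) (1 / ((f₂ : ℝ) - M)))
    (hroot : ∑ l ∈ Finset.Icc f₁ f₂,
        ((l : ℝ) - M) * ‖w l‖ ^ 2 / (1 - ((l : ℝ) - M) * r) ^ 2 = 0)
    (s : ℝ)
    (hs : s = ∑ l ∈ Finset.Icc f₁ f₂, ‖w l‖ ^ 2 / (1 - ((l : ℝ) - M) * r) ^ 2)
    (z : ℤ → EuclideanSpace ℝ (Fin (2 * n)))
    (hz : ∀ l : ℤ, z l = if l ∈ Finset.Icc f₁ f₂ then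
        (Real.sqrt s * (1 - ((l : ℝ) - M) * r))⁻¹ • w l else 0) :
    0 < s ∧
    (∀ l ∈ Finset.Icc f₁ f₂, 0 < 1 - ((l : ℝ) - M) * r) ∧
    (∑ l ∈ Finset.Icc (-(F : ℤ)) (F : ℤ), ‖z l‖ ^ 2 = 1) ∧
    (∑ l ∈ Finset.Icc (-(F : ℤ)) (F : ℤ), (l : ℝ) * ‖z l‖ ^ 2 = M) := by
  have hneg : (f₁ : ℝ) - M < 0 := by
    obtain ⟨l, hl, hw⟩ := hΩ1
    have : (f₁ : ℝ) ≤ l := mod_cast (hminmax l hw).1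
    linarith
  have hpos : 0 < (f₂ : ℝ) - M := by
    obtain ⟨l, hl, hw⟩ := hΩ2
    have : (l : ℝ) ≤ f₂ := mod_cast (hminmax l hw).2
    linarith
  have h₁ : ((f₁ : ℝ) - M) * r < 1 := by
    have := (div_lt_iff_of_neg hneg).1 hr.1
    linarith
  have h₂ : ((f₂ : ℝ) - M) * r < 1 := by
    have := (lt_div_iff₀ hpos).1 hr.2
    linarith
  have hden : ∀ l ∈ Finset.Icc f₁ f₂, 0 < 1 - ((l : ℝ) - M) * r := by
    intro l hl
    obtain ⟨hl₁, hl₂⟩ := Finset.mem_Icc.1 hl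
    have hl₁' : (f₁ : ℝ) ≤ l := mod_cast hl₁
    have hl₂' : (l : ℝ) ≤ f₂ := mod_cast hl₂
    exact one_sub_mul_pos_of_mem_Icc h₁ h₂ ⟨by linarith, by linarith⟩
  have hf₁ : f₁ ∈ Finset.Icc f₁ f₂ := Finset.mem_Icc.2 ⟨le_rfl, (hminmax f₁ hwf₁).2⟩
  have hspos : 0 < s := by
    rw [hs]
    refine Finset.sum_pos' (fun l _ => by positivity) ⟨f₁, hf₁, ?_⟩
    have := hden f₁ hf₁
    have := norm_pos_iff.2 hwf₁
    positivity
  have hsub : Finset.Icc f₁ f₂ ⊆ Finset.Icc (-(F : ℤ)) (F : ℤ) :=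
    Finset.Icc_subset_Icc
      (Finset.mem_Icc.1 (not_imp_comm.1 (hsupp f₁) hwf₁)).1
      (Finset.mem_Icc.1 (not_imp_comm.1 (hsupp f₂) hwf₂)).2
  have hz_out : ∀ l ∉ Finset.Icc f₁ f₂, z l = 0 := fun l hl => by rw [hz, if_neg hl]
  have hz_in : ∀ l ∈ Finset.Icc f₁ f₂,
      ‖z l‖ ^ 2 = ‖w l‖ ^ 2 / (1 - ((l : ℝ) - M) * r) ^ 2 / s := by
    intro l hl
    rw [hz, if_pos hl, norm_smul, mul_pow, Real.norm_eq_abs, sq_abs, inv_pow, mul_pow,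
      Real.sq_sqrt hspos.le, div_div, div_eq_inv_mul, mul_comm s]
  have hnorm : ∑ l ∈ Finset.Icc (-(F : ℤ)) (F : ℤ), ‖z l‖ ^ 2 = 1 := by
    rw [← Finset.sum_subset hsub fun l _ hl => by simp [hz_out l hl],
      Finset.sum_congr rfl hz_in, ← Finset.sum_div, ← hs, div_self hspos.ne']
  have hcentered : ∑ l ∈ Finset.Icc (-(F : ℤ)) (F : ℤ), ((l : ℝ) - M) * ‖z l‖ ^ 2 = 0 := by
    rw [← Finset.sum_subset hsub fun l _ hl => by simp [hz_out l hl],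
      Finset.sum_congr rfl fun l hl => by rw [hz_in l hl, ← mul_div_assoc, ← mul_div_assoc],
      ← Finset.sum_div, hroot, zero_div]
  refine ⟨hspos, hden, hnorm, ?_⟩
  simp only [sub_mul, Finset.sum_sub_distrib, ← Finset.mul_sum, hnorm] at hcentered
  linarith
end

section
/- (Spin-1 projection, case M = 0.) Let F = 1 and M = 0, and let w = (w_1, w_0, w_{−1}) ∈ ℝ^N with w_1 ≠ 0 and w_{−1} ≠ 0. Set t = √(‖w_0‖² + (‖w_1‖ + ‖w_{−1}‖)²/2), and define z_0 = w_0/t and z_l = ((‖w_1‖ + ‖w_{−1}‖)/(2t‖w_l‖))·w_l for l = ±1. Then z ∈ 𝓜 and z minimizes ‖y − w‖ over all y ∈ 𝓜, i.e. ‖z − w‖ ≤ ‖y − w‖ for every y ∈ 𝓜. -/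
open scoped RealInnerProductSpace

theorem sum_Icc_neg_one_one {M : Type*} [AddCommMonoid M] (f : ℤ → M) :
    ∑ l ∈ Finset.Icc (-1 : ℤ) (1 : ℤ), f l = f (-1) + f 0 + f 1 := by
  have h : Finset.Icc (-1 : ℤ) (1 : ℤ) = {-1, 0, 1} := by decide
  simp [h, add_assoc]

/-- The Cauchy–Schwarz inequality in the plane with weights `1` and `2`. -/
theorem mul_add_mul_le_sqrt_of_sq_add_two_mul_sq {p r : ℝ} (c s : ℝ)
    (h : p ^ 2 + 2 * r ^ 2 = 1) : p * c + r * s ≤ √(c ^ 2 + s ^ 2 / 2) := by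
  apply Real.le_sqrt_of_sq_le
  calc (p * c + r * s) ^ 2
      ≤ (p * c + r * s) ^ 2 + (p * s - 2 * r * c) ^ 2 / 2 := by
        linarith [sq_nonneg (p * s - 2 * r * c)]
    _ = (p ^ 2 + 2 * r ^ 2) * (c ^ 2 + s ^ 2 / 2) := by ring
    _ = c ^ 2 + s ^ 2 / 2 := by rw [h, one_mul]

/-- spin-1 projection, case `M = 0`: for `w = (w₁, w₀, w₋₁)` with
`w₁ ≠ 0` and `w₋₁ ≠ 0`, set `t = √(‖w₀‖² + (‖w₁‖+‖w₋₁‖)²/2)`, `z₀ = w₀/t`,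
`z_l = ((‖w₁‖+‖w₋₁‖)/(2t‖w_l‖))·w_l` for `l = ±1`.  Then `z ∈ 𝓜` (with `M = 0`)
and `‖z − w‖ ≤ ‖y − w‖` for every `y ∈ 𝓜`. -/
theorem spin1_projection_M_eq_zero
    (n : ℕ) (hn : 1 ≤ n)
    (w : ℤ → EuclideanSpace ℝ (Fin (2 * n)))
    (hsupp : ∀ l : ℤ, l ∉ Finset.Icc (-1 : ℤ) (1 : ℤ) → w l = 0)
    (hw1 : w 1 ≠ 0) (hwm1 : w (-1) ≠ 0)
    (t : ℝ) (ht : t = Real.sqrt (‖w 0‖ ^ 2 + (‖w 1‖ + ‖w (-1)‖) ^ 2 / 2))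
    (z : ℤ → EuclideanSpace ℝ (Fin (2 * n)))
    (hz0 : z 0 = t⁻¹ • w 0)
    (hz1 : z 1 = ((‖w 1‖ + ‖w (-1)‖) / (2 * t * ‖w 1‖)) • w 1)
    (hzm1 : z (-1) = ((‖w 1‖ + ‖w (-1)‖) / (2 * t * ‖w (-1)‖)) • w (-1))
    (hzsupp : ∀ l : ℤ, l ∉ Finset.Icc (-1 : ℤ) (1 : ℤ) → z l = 0) :
    (∑ l ∈ Finset.Icc (-1 : ℤ) (1 : ℤ), ‖z l‖ ^ 2 = 1) ∧
    (∑ l ∈ Finset.Icc (-1 : ℤ) (1 : ℤ), (l : ℝ) * ‖z l‖ ^ 2 = 0) ∧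
    (∀ y : ℤ → EuclideanSpace ℝ (Fin (2 * n)),
      (∀ l : ℤ, l ∉ Finset.Icc (-1 : ℤ) (1 : ℤ) → y l = 0) →
      (∑ l ∈ Finset.Icc (-1 : ℤ) (1 : ℤ), ‖y l‖ ^ 2 = 1) →
      (∑ l ∈ Finset.Icc (-1 : ℤ) (1 : ℤ), (l : ℝ) * ‖y l‖ ^ 2 = 0) →
      Real.sqrt (∑ l ∈ Finset.Icc (-1 : ℤ) (1 : ℤ), ‖z l - w l‖ ^ 2)
        ≤ Real.sqrt (∑ l ∈ Finset.Icc (-1 : ℤ) (1 : ℤ), ‖y l - w l‖ ^ 2)) := by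
  simp only [sum_Icc_neg_one_one]
  have ha : 0 < ‖w 1‖ := norm_pos_iff.mpr hw1
  have hb : 0 < ‖w (-1)‖ := norm_pos_iff.mpr hwm1
  have htpos : 0 < t := by rw [ht]; positivity
  have htsq : t ^ 2 = ‖w 0‖ ^ 2 + (‖w 1‖ + ‖w (-1)‖) ^ 2 / 2 := by
    rw [ht]; exact Real.sq_sqrt (by positivity)
  have hn0 : ‖z 0‖ = ‖w 0‖ / t := by
    rw [hz0, norm_smul, Real.norm_of_nonneg (by positivity)]; field_simp
  have hn1 : ‖z 1‖ = (‖w 1‖ + ‖w (-1)‖) / (2 * t) := by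
    rw [hz1, norm_smul, Real.norm_of_nonneg (by positivity)]; field_simp
  have hnm1 : ‖z (-1)‖ = (‖w 1‖ + ‖w (-1)‖) / (2 * t) := by
    rw [hzm1, norm_smul, Real.norm_of_nonneg (by positivity)]; field_simp
  have hzsphere : ‖z (-1)‖ ^ 2 + ‖z 0‖ ^ 2 + ‖z 1‖ ^ 2 = 1 := by
    rw [hn0, hn1, hnm1]
    field_simp
    linarith
  have hzinner : ⟪z (-1), w (-1)⟫ + ⟪z 0, w 0⟫ + ⟪z 1, w 1⟫ = t := by
    rw [hz0, hz1, hzm1]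
    simp only [real_inner_smul_left, real_inner_self_eq_norm_sq]
    field_simp
    linarith
  refine ⟨hzsphere, by rw [hn1, hnm1]; push_cast; ring, fun y _ hysphere hymag => ?_⟩
  apply Real.sqrt_le_sqrt
  push_cast at hymag
  have hynorm : ‖y (-1)‖ = ‖y 1‖ :=
    (sq_eq_sq₀ (norm_nonneg _) (norm_nonneg _)).mp (by linarith)
  have hyinner : ⟪y (-1), w (-1)⟫ + ⟪y 0, w 0⟫ + ⟪y 1, w 1⟫ ≤ t :=
    calc ⟪y (-1), w (-1)⟫ + ⟪y 0, w 0⟫ + ⟪y 1, w 1⟫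
        ≤ ‖y (-1)‖ * ‖w (-1)‖ + ‖y 0‖ * ‖w 0‖ + ‖y 1‖ * ‖w 1‖ := by
          gcongr <;> exact real_inner_le_norm _ _
      _ = ‖y 0‖ * ‖w 0‖ + ‖y 1‖ * (‖w 1‖ + ‖w (-1)‖) := by rw [hynorm]; ring
      _ ≤ t := by
          rw [ht]
          apply mul_add_mul_le_sqrt_of_sq_add_two_mul_sq
          rw [hynorm] at hysphere
          linarith
  simp only [norm_sub_sq_real]
  linarith
end

section
/- Let 0 < M < 1 and let a, b > 0 be real numbers. Then the equation (s/(√2·√(1 + M − s²)))·a + (s/(√2·√(1 − M − s²)))·b = 1 has exactly one solution s in the open interval (0, √(1 − M)). -/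
/-- The function `s ↦ s / (√2 √(c - s²))` is strictly increasing on `[0, √c)`. -/
theorem strictMonoOn_div_sqrt_two_mul_sqrt_sub_sq (c : ℝ) :
    StrictMonoOn (fun s : ℝ => s / (Real.sqrt 2 * Real.sqrt (c - s ^ 2)))
      (Set.Ico 0 (Real.sqrt c)) := by
  intro s hs t ht hst
  have htc : t ^ 2 < c := (Real.lt_sqrt ht.1).1 ht.2
  have hsq : s ^ 2 ≤ t ^ 2 := pow_le_pow_left₀ hs.1 hst.le 2
  have hpos : 0 < Real.sqrt (c - t ^ 2) := Real.sqrt_pos.2 (by linarith)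
  exact div_lt_div₀ hst (by gcongr) ht.1 (by positivity)

/-- The function `s ↦ s / (√2 √(c - s²))` is continuous on `[0, √c)`. -/
theorem continuousOn_div_sqrt_two_mul_sqrt_sub_sq (c : ℝ) :
    ContinuousOn (fun s : ℝ => s / (Real.sqrt 2 * Real.sqrt (c - s ^ 2)))
      (Set.Ico 0 (Real.sqrt c)) := by
  refine ContinuousOn.div (by fun_prop) (by fun_prop) fun t ht => ?_
  have htc : t ^ 2 < c := (Real.lt_sqrt ht.1).1 ht.2
  have hpos : 0 < Real.sqrt (c - t ^ 2) := Real.sqrt_pos.2 (by linarith)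
  positivity

/-- For `b, c > 0` the equation `s / (√2 √(c - s²)) * b = 1` has a solution in `(0, √c)`. -/
theorem exists_div_sqrt_two_mul_sqrt_sub_sq_mul_eq_one {b c : ℝ} (hb : 0 < b) (hc : 0 < c) :
    ∃ s ∈ Set.Ioo 0 (Real.sqrt c), s / (Real.sqrt 2 * Real.sqrt (c - s ^ 2)) * b = 1 := by
  have hq : 0 < 2 * c / (b ^ 2 + 2) := by positivity
  refine ⟨Real.sqrt (2 * c / (b ^ 2 + 2)), ⟨Real.sqrt_pos.2 hq, ?_⟩, ?_⟩
  · refine Real.sqrt_lt_sqrt hq.le ?_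
    rw [div_lt_iff₀ (by positivity)]
    nlinarith [mul_pos hc (pow_pos hb 2)]
  · have hden : Real.sqrt 2 * Real.sqrt (c - 2 * c / (b ^ 2 + 2))
        = Real.sqrt (2 * c / (b ^ 2 + 2)) * b := by
      rw [← Real.sqrt_mul zero_le_two,
        show 2 * (c - 2 * c / (b ^ 2 + 2)) = 2 * c / (b ^ 2 + 2) * b ^ 2 by field_simp; ring,
        Real.sqrt_mul hq.le, Real.sqrt_sq hb.le]
    have hs : 0 < Real.sqrt (2 * c / (b ^ 2 + 2)) := Real.sqrt_pos.2 hq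
    rw [Real.sq_sqrt hq.le, hden]
    field_simp

/-- For `0 < M < 1` and `a, b > 0`, the equation
`(s/(√2·√(1+M−s²)))·a + (s/(√2·√(1−M−s²)))·b = 1` has exactly one solution `s`
in the open interval `(0, √(1−M))`. -/
theorem unique_solution_spin1_case4
    (M a b : ℝ) (hM0 : 0 < M) (hM1 : M < 1) (ha : 0 < a) (hb : 0 < b) :
    ∃! s : ℝ, s ∈ Set.Ioo 0 (Real.sqrt (1 - M)) ∧
      s / (Real.sqrt 2 * Real.sqrt (1 + M - s ^ 2)) * a
        + s / (Real.sqrt 2 * Real.sqrt (1 - M - s ^ 2)) * b = 1 := by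
  set f : ℝ → ℝ := fun s => s / (Real.sqrt 2 * Real.sqrt (1 + M - s ^ 2)) * a
    + s / (Real.sqrt 2 * Real.sqrt (1 - M - s ^ 2)) * b with hf
  have hsub : Set.Ico 0 (Real.sqrt (1 - M)) ⊆ Set.Ico 0 (Real.sqrt (1 + M)) :=
    Set.Ico_subset_Ico_right (Real.sqrt_le_sqrt (by linarith))
  have hmono : StrictMonoOn f (Set.Ico 0 (Real.sqrt (1 - M))) := fun s hs t ht hst =>
    add_lt_add
      (mul_lt_mul_of_pos_right
        (strictMonoOn_div_sqrt_two_mul_sqrt_sub_sq _ (hsub hs) (hsub ht) hst) ha)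
      (mul_lt_mul_of_pos_right (strictMonoOn_div_sqrt_two_mul_sqrt_sub_sq _ hs ht hst) hb)
  have hcont : ContinuousOn f (Set.Ico 0 (Real.sqrt (1 - M))) :=
    (((continuousOn_div_sqrt_two_mul_sqrt_sub_sq _).mono hsub).mul continuousOn_const).add
      ((continuousOn_div_sqrt_two_mul_sqrt_sub_sq _).mul continuousOn_const)
  obtain ⟨r, hr, hrb⟩ :=
    exists_div_sqrt_two_mul_sqrt_sub_sq_mul_eq_one hb (sub_pos.2 hM1)
  have hf0 : f 0 < 1 := by simp [hf]
  have hfr : 1 ≤ f r := by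
    have hr0 : 0 < r := hr.1
    have : 0 ≤ r / (Real.sqrt 2 * Real.sqrt (1 + M - r ^ 2)) * a := by positivity
    simp only [hf, hrb]
    linarith
  obtain ⟨s, hs, hs1⟩ := intermediate_value_Ioc hr.1.le
    (hcont.mono (Set.Icc_subset_Ico_right hr.2)) ⟨hf0, hfr⟩
  have hs' : s ∈ Set.Ioo 0 (Real.sqrt (1 - M)) := ⟨hs.1, hs.2.trans_lt hr.2⟩
  refine ⟨s, ⟨hs', hs1⟩, fun t ht => ?_⟩
  exact hmono.injOn (Set.Ioo_subset_Ico_self ht.1) (Set.Ioo_subset_Ico_self hs')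
    (ht.2.trans hs1.symm)
end

section
/- Let w ∈ Ω, write f₁ = f₁(w) and f₂ = f₂(w), and define the polynomial h₃(t) = Σ_{l=0}^{f₂−f₁} (l + f₁ − M)‖w_{l+f₁}‖²·t^l. Then at every positive zero r₀ of h₃ (i.e. r₀ > 0 with h₃(r₀) = 0) one has h₃′(r₀) > 0. Consequently h₃ has exactly one positive zero. -/
open scoped RealInnerProductSpace

section ShiftedWeightSum

variable {c : ℕ → ℝ} {a : ℝ} {m : ℕ}

/-- At a positive zero of `∑ (l - a) c_l t^l` with nonnegative weights `c_l`, the formal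
derivative is positive: `r h'(r) = ∑ (l - a)² c_l r^l + a h(r)`. -/
lemma deriv_shifted_weight_sum_pos (hc : ∀ l, 0 ≤ c l) (hc0 : 0 < c 0) (ha : 0 < a)
    {r : ℝ} (hr : 0 < r)
    (hzero : ∑ l ∈ Finset.range (m + 1), ((l : ℝ) - a) * c l * r ^ l = 0) :
    0 < deriv (fun t : ℝ => ∑ l ∈ Finset.range (m + 1), ((l : ℝ) - a) * c l * t ^ l) r := by
  have hderiv : HasDerivAt
      (fun t : ℝ => ∑ l ∈ Finset.range (m + 1), ((l : ℝ) - a) * c l * t ^ l)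
      (∑ l ∈ Finset.range (m + 1), ((l : ℝ) - a) * c l * ((l : ℝ) * r ^ (l - 1))) r :=
    HasDerivAt.fun_sum fun l _ => (hasDerivAt_pow l r).const_mul _
  rw [hderiv.deriv]
  have hsq : 0 < ∑ l ∈ Finset.range (m + 1), ((l : ℝ) - a) ^ 2 * c l * r ^ l := by
    refine Finset.sum_pos' (fun l _ => ?_) ⟨0, by simp, ?_⟩
    · have := hc l
      positivity
    · simp only [Nat.cast_zero, zero_sub, even_two, Even.neg_pow, pow_zero, mul_one]
      positivity
  have heuler : r * ∑ l ∈ Finset.range (m + 1), ((l : ℝ) - a) * c l * ((l : ℝ) * r ^ (l - 1))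
      = ∑ l ∈ Finset.range (m + 1), ((l : ℝ) - a) ^ 2 * c l * r ^ l
        + a * ∑ l ∈ Finset.range (m + 1), ((l : ℝ) - a) * c l * r ^ l := by
    rw [Finset.mul_sum, Finset.mul_sum, ← Finset.sum_add_distrib]
    refine Finset.sum_congr rfl fun l _ => ?_
    rcases l with _ | l
    · simp only [Nat.cast_zero]
      ring
    · simp only [Nat.add_sub_cancel]
      ring
  rw [hzero, mul_zero, add_zero] at heuler
  exact pos_of_mul_pos_right (heuler ▸ hsq) hr.le

/-- `t ↦ t ^ (-a) * ∑ (l - a) c_l t^l` is strictly increasing on the positive reals. -/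
lemma rpow_mul_shifted_weight_sum_lt (hc : ∀ l, 0 ≤ c l) (hc0 : 0 < c 0) (ha : 0 < a)
    {s t : ℝ} (hs : 0 < s) (hst : s < t) :
    (t / s) ^ a * ∑ l ∈ Finset.range (m + 1), ((l : ℝ) - a) * c l * s ^ l
      < ∑ l ∈ Finset.range (m + 1), ((l : ℝ) - a) * c l * t ^ l := by
  have hone : 1 < t / s := (one_lt_div hs).2 hst
  have hpow (l : ℕ) : t ^ l = (t / s) ^ (l : ℝ) * s ^ l := by
    rw [Real.rpow_natCast, div_pow, div_mul_cancel₀ _ (pow_pos hs l).ne']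
  rw [Finset.mul_sum]
  refine Finset.sum_lt_sum (fun l _ => ?_) ⟨0, by simp, ?_⟩
  · have hmono : 0 ≤ ((l : ℝ) - a) * ((t / s) ^ (l : ℝ) - (t / s) ^ a) := by
      rcases le_total a l with h | h
      · exact mul_nonneg (sub_nonneg.2 h)
          (sub_nonneg.2 (Real.rpow_le_rpow_of_exponent_le hone.le h))
      · exact mul_nonneg_of_nonpos_of_nonpos (sub_nonpos.2 h)
          (sub_nonpos.2 (Real.rpow_le_rpow_of_exponent_le hone.le h))
    have := mul_nonneg hmono (mul_nonneg (hc l) (pow_pos hs l).le)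
    rw [hpow l]
    linarith
  · have := mul_pos (mul_pos ha hc0) (sub_pos.2 (Real.one_lt_rpow hone ha))
    simp only [Nat.cast_zero, pow_zero]
    linarith

lemma exists_shifted_weight_sum_pos (hc : ∀ l, 0 ≤ c l) (hcm : 0 < c (m + 1)) (ha : 0 < a)
    (ham : a < ((m + 1 : ℕ) : ℝ)) :
    ∃ t : ℝ, 0 < t ∧ 0 < ∑ l ∈ Finset.range (m + 1 + 1), ((l : ℝ) - a) * c l * t ^ l := by
  set S := ∑ l ∈ Finset.range (m + 1), a * c l with hS
  set k := (((m + 1 : ℕ) : ℝ) - a) * c (m + 1) with hk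
  have hk0 : 0 < k := mul_pos (sub_pos.2 ham) hcm
  have hS0 : 0 ≤ S := Finset.sum_nonneg fun l _ => mul_nonneg ha.le (hc l)
  set t := 1 + S / k with ht
  have ht1 : 1 ≤ t := le_add_of_nonneg_right (by positivity)
  have ht0 : 0 < t := by linarith
  refine ⟨t, ht0, ?_⟩
  have hlow : -(S * t ^ m) ≤ ∑ l ∈ Finset.range (m + 1), ((l : ℝ) - a) * c l * t ^ l := by
    rw [hS, Finset.sum_mul, ← Finset.sum_neg_distrib]
    refine Finset.sum_le_sum fun l hl => ?_
    have hle : t ^ l ≤ t ^ m :=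
      pow_le_pow_right₀ ht1 (Nat.lt_succ_iff.1 (Finset.mem_range.1 hl))
    have h₁ := mul_le_mul_of_nonneg_left hle (mul_nonneg ha.le (hc l))
    have h₂ := mul_nonneg (mul_nonneg l.cast_nonneg (hc l)) (pow_pos ht0 l).le
    linarith
  have hkt : k * t = k + S := by
    rw [ht, mul_add, mul_one, mul_div_cancel₀ _ hk0.ne']
  have htop : k * t ^ (m + 1) = k * t ^ m + S * t ^ m := by
    rw [← add_mul, ← hkt]
    ring
  have hpos := mul_pos hk0 (pow_pos ht0 m)
  rw [Finset.sum_range_succ, ← hk, htop]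
  linarith

lemma existsUnique_pos_zero_shifted_weight_sum (hc : ∀ l, 0 ≤ c l) (hc0 : 0 < c 0)
    (hcm : 0 < c m) (ha : 0 < a) (ham : a < (m : ℝ)) :
    ∃! r : ℝ, 0 < r ∧ ∑ l ∈ Finset.range (m + 1), ((l : ℝ) - a) * c l * r ^ l = 0 := by
  have hlt {s t : ℝ} (hs : 0 < s) (hst : s < t)
      (hs' : ∑ l ∈ Finset.range (m + 1), ((l : ℝ) - a) * c l * s ^ l = 0) :
      0 < ∑ l ∈ Finset.range (m + 1), ((l : ℝ) - a) * c l * t ^ l := by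
    simpa [hs'] using rpow_mul_shifted_weight_sum_lt (m := m) hc hc0 ha hs hst
  obtain ⟨T, hT, hTpos⟩ :
      ∃ t : ℝ, 0 < t ∧ 0 < ∑ l ∈ Finset.range (m + 1), ((l : ℝ) - a) * c l * t ^ l := by
    rcases m with _ | m
    · simp only [Nat.cast_zero] at ham
      linarith
    · exact exists_shifted_weight_sum_pos hc hcm ha ham
  have hneg : ∑ l ∈ Finset.range (m + 1), ((l : ℝ) - a) * c l * (0 : ℝ) ^ l < 0 := by
    rw [Finset.sum_range_succ']
    simpa using mul_pos ha hc0
  have hcont : Continuous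
      fun t : ℝ => ∑ l ∈ Finset.range (m + 1), ((l : ℝ) - a) * c l * t ^ l := by
    fun_prop
  obtain ⟨r, hr, hr0⟩ := intermediate_value_Ioo hT.le hcont.continuousOn ⟨hneg, hTpos⟩
  refine ⟨r, ⟨hr.1, hr0⟩, fun s hs => ?_⟩
  rcases lt_trichotomy s r with h | h | h
  · exact absurd hr0 (hlt hs.1 h hs.2).ne'
  · exact h
  · exact absurd hs.2 (hlt hr.1 h hr0).ne'

end ShiftedWeightSum

/-- For `w ∈ Ω` with `f₁ = f₁(w)`, `f₂ = f₂(w)`, the polynomial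
`h₃(t) = Σ_{l=0}^{f₂−f₁} (l+f₁−M)‖w_{l+f₁}‖²·t^l` has `h₃′(r₀) > 0` at every
positive zero `r₀`, and consequently has exactly one positive zero. -/
theorem spinF_h3_unique_positive_zero
    (F n : ℕ) (hF : 1 ≤ F) (hn : 1 ≤ n) (M : ℝ)
    (hM0 : 0 ≤ M) (hMF : M < (F : ℝ))
    (w : ℤ → EuclideanSpace ℝ (Fin (2 * n)))
    (hsupp : ∀ l : ℤ, l ∉ Finset.Icc (-(F : ℤ)) (F : ℤ) → w l = 0)
    -- `w ∈ Ω`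
    (hΩ1 : ∃ l : ℤ, (l : ℝ) < M ∧ w l ≠ 0)
    (hΩ2 : ∃ l : ℤ, M < (l : ℝ) ∧ w l ≠ 0)
    -- `f₁ = min{l : w_l ≠ 0}`, `f₂ = max{l : w_l ≠ 0}`
    (f₁ f₂ : ℤ) (hwf₁ : w f₁ ≠ 0) (hwf₂ : w f₂ ≠ 0)
    (hminmax : ∀ l : ℤ, w l ≠ 0 → f₁ ≤ l ∧ l ≤ f₂)
    (h₃ : ℝ → ℝ)
    (hh₃ : ∀ t : ℝ, h₃ t = ∑ l ∈ Finset.range ((f₂ - f₁).toNat + 1),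
        ((l : ℝ) + (f₁ : ℝ) - M) * ‖w ((l : ℤ) + f₁)‖ ^ 2 * t ^ l) :
    (∀ r₀ : ℝ, 0 < r₀ → h₃ r₀ = 0 → 0 < deriv h₃ r₀) ∧
    (∃! r : ℝ, 0 < r ∧ h₃ r = 0) := by
  have hle : f₁ ≤ f₂ := (hminmax f₁ hwf₁).2
  obtain ⟨m, hm⟩ : ∃ m : ℕ, f₂ - f₁ = m := Int.eq_ofNat_of_zero_le (sub_nonneg.2 hle)
  have hf₁ : (f₁ : ℝ) < M := by
    obtain ⟨l, hl, hwl⟩ := hΩ1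
    exact lt_of_le_of_lt (by exact_mod_cast (hminmax l hwl).1) hl
  have hf₂ : M < (f₂ : ℝ) := by
    obtain ⟨l, hl, hwl⟩ := hΩ2
    exact lt_of_lt_of_le hl (by exact_mod_cast (hminmax l hwl).2)
  have hmf : (m : ℝ) = f₂ - f₁ := by exact_mod_cast hm.symm
  set c : ℕ → ℝ := fun l => ‖w ((l : ℤ) + f₁)‖ ^ 2 with hcdef
  have hc : ∀ l, 0 ≤ c l := fun l => sq_nonneg _
  have hc0 : 0 < c 0 := by
    have := norm_pos_iff.2 hwf₁
    simp only [hcdef, Nat.cast_zero, zero_add]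
    positivity
  have hcm : 0 < c m := by
    have := norm_pos_iff.2 hwf₂
    simp only [hcdef, ← hm, sub_add_cancel]
    positivity
  have hfun : h₃ = fun t : ℝ =>
      ∑ l ∈ Finset.range (m + 1), ((l : ℝ) - (M - f₁)) * c l * t ^ l := by
    funext t
    rw [hh₃, hm, Int.toNat_natCast]
    refine Finset.sum_congr rfl fun l _ => ?_
    rw [sub_sub_eq_add_sub]
  subst hfun
  exact ⟨fun r hr hzero => deriv_shifted_weight_sum_pos hc hc0 (sub_pos.2 hf₁) hr hzero,
    existsUnique_pos_zero_shifted_weight_sum hc hc0 hcm (sub_pos.2 hf₁) (by linarith)⟩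
end

section
/- Let w ∈ Ω and let r > 0 be the unique positive zero of h₂(t) = Σ_{l=0}^{2F} (l − F − M)‖w_{l−F}‖²·t^l. Then the vector z defined blockwise by z_l = √(r^l / Σ_{k=−F}^{F} ‖w_k‖²·r^k)·w_l for l = F, …, −F satisfies zᵀz = 1 and zᵀΓz = M, i.e. z ∈ 𝓜. -/
open scoped RealInnerProductSpace

/-- Reindexing of a sum over the symmetric integer interval by natural numbers. -/
theorem sum_range_sub_eq_sum_Icc_neg {α : Type*} [AddCommMonoid α] (F : ℕ) (f : ℤ → α) :
    ∑ l ∈ Finset.range (2 * F + 1), f ((l : ℤ) - (F : ℤ)) =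
      ∑ l ∈ Finset.Icc (-(F : ℤ)) (F : ℤ), f l := by
  refine Finset.sum_bij' (fun l _ => (l : ℤ) - F) (fun l _ => (l + F).toNat) ?_ ?_ ?_ ?_ ?_ <;>
    intro a ha <;> simp only [Finset.mem_range, Finset.mem_Icc] at * <;> omega

/-- For `w ∈ Ω` and `r > 0` the (unique) positive zero of
`h₂(t) = Σ_{l=0}^{2F} (l−F−M)‖w_{l−F}‖²·t^l`, the vector `z` with
`z_l = √(r^l / Σ_{k=−F}^{F} ‖w_k‖²·r^k)·w_l` belongs to `𝓜`, i.e. `zᵀz = 1` and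
`zᵀΓz = M`.  (Here `r^l` for integer index `l` is the real power `r^(l : ℝ)`.) -/
theorem spinF_orthogonal_retraction_in_M
    (F n : ℕ) (hF : 1 ≤ F) (hn : 1 ≤ n) (M : ℝ)
    (hM0 : 0 ≤ M) (hMF : M < (F : ℝ))
    (w : ℤ → EuclideanSpace ℝ (Fin (2 * n)))
    (hsupp : ∀ l : ℤ, l ∉ Finset.Icc (-(F : ℤ)) (F : ℤ) → w l = 0)
    -- `w ∈ Ω`
    (hΩ1 : ∃ l : ℤ, (l : ℝ) < M ∧ w l ≠ 0)
    (hΩ2 : ∃ l : ℤ, M < (l : ℝ) ∧ w l ≠ 0)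
    -- `r` is the positive zero of `h₂`
    (r : ℝ) (hrpos : 0 < r)
    (hroot : ∑ l ∈ Finset.range (2 * F + 1),
        ((l : ℝ) - (F : ℝ) - M) * ‖w ((l : ℤ) - (F : ℤ))‖ ^ 2 * r ^ l = 0)
    (z : ℤ → EuclideanSpace ℝ (Fin (2 * n)))
    (hz : ∀ l : ℤ, z l = Real.sqrt (r ^ (l : ℝ)
        / ∑ k ∈ Finset.Icc (-(F : ℤ)) (F : ℤ), ‖w k‖ ^ 2 * r ^ (k : ℝ)) • w l) :
    (∑ l ∈ Finset.Icc (-(F : ℤ)) (F : ℤ), ‖z l‖ ^ 2 = 1) ∧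
    (∑ l ∈ Finset.Icc (-(F : ℤ)) (F : ℤ), (l : ℝ) * ‖z l‖ ^ 2 = M) := by
  have hsum : ∑ l ∈ Finset.Icc (-(F : ℤ)) (F : ℤ),
      ((l : ℝ) - M) * (‖w l‖ ^ 2 * r ^ (l : ℝ)) = 0 := by
    have hscale : ∑ l ∈ Finset.Icc (-(F : ℤ)) (F : ℤ),
        ((l : ℝ) - M) * (‖w l‖ ^ 2 * r ^ (l : ℝ)) * r ^ (F : ℝ) = 0 := by
      rw [← sum_range_sub_eq_sum_Icc_neg, ← hroot]
      refine Finset.sum_congr rfl fun l _ => ?_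
      have hpow : r ^ (((l : ℤ) - (F : ℤ) : ℤ) : ℝ) * r ^ (F : ℝ) = r ^ l := by
        rw [← Real.rpow_add hrpos, ← Real.rpow_natCast]
        push_cast
        ring_nf
      rw [← hpow]
      push_cast
      ring
    rw [← Finset.sum_mul] at hscale
    exact (mul_eq_zero.mp hscale).resolve_right (Real.rpow_pos_of_pos hrpos _).ne'
  set S := ∑ k ∈ Finset.Icc (-(F : ℤ)) (F : ℤ), ‖w k‖ ^ 2 * r ^ (k : ℝ) with hS
  have hSpos : 0 < S := by
    obtain ⟨l, -, hl⟩ := hΩ1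
    have hmem : l ∈ Finset.Icc (-(F : ℤ)) (F : ℤ) := by
      by_contra h
      exact hl (hsupp l h)
    exact Finset.sum_pos' (fun k _ => by positivity) ⟨l, hmem, by positivity⟩
  have hnorm (l : ℤ) : ‖z l‖ ^ 2 = ‖w l‖ ^ 2 * r ^ (l : ℝ) / S := by
    rw [hz, norm_smul, mul_pow, Real.norm_eq_abs, sq_abs, Real.sq_sqrt (by positivity)]
    ring
  simp only [hnorm, ← mul_div_assoc, ← Finset.sum_div]
  refine ⟨div_self hSpos.ne', ?_⟩
  rw [div_eq_iff hSpos.ne', ← sub_eq_zero, ← hsum, hS, Finset.mul_sum, ← Finset.sum_sub_distrib]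
  exact Finset.sum_congr rfl fun l _ => by ring
end

section
/- For every w ∈ Ω there exists a unique pair of positive real numbers (σ₀, r) such that the vector u defined blockwise by u_l = σ₀·r^{l/2}·w_l for l = F, …, −F belongs to 𝓜. Equivalently, the map φ : 𝓜 × (0,∞)² → Ω given by φ(u, (v₁, v₂))_l = u_l/(v₁·v₂^{l/2}) is a bijection. -/
open scoped RealInnerProductSpace

section ExponentialSum

variable {ι : Type*} {s : Finset ι} {a c : ι → ℝ}

theorem exists_sum_mul_exp_nonneg (ha : ∀ i ∈ s, 0 ≤ a i)
    (hpos : ∃ i ∈ s, 0 < c i ∧ 0 < a i) :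
    ∃ t : ℝ, 0 ≤ ∑ i ∈ s, a i * (c i * Real.exp (c i * t)) := by
  classical
  obtain ⟨j, hj, hcj, haj⟩ := hpos
  set B : ℝ := ∑ i ∈ s.erase j, a i * |c i| with hB
  have hB0 : 0 ≤ B := Finset.sum_nonneg fun i hi =>
    mul_nonneg (ha i (Finset.mem_of_mem_erase hi)) (abs_nonneg _)
  have ht : 0 ≤ B / (a j * c j * c j) := by positivity
  refine ⟨B / (a j * c j * c j), ?_⟩
  set t : ℝ := B / (a j * c j * c j) with ht_def
  rw [← Finset.add_sum_erase s _ hj]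
  have hrest : -B ≤ ∑ i ∈ s.erase j, a i * (c i * Real.exp (c i * t)) := by
    rw [hB, ← Finset.sum_neg_distrib]
    refine Finset.sum_le_sum fun i hi => ?_
    rw [← mul_neg]
    refine mul_le_mul_of_nonneg_left ?_ (ha i (Finset.mem_of_mem_erase hi))
    rcases le_or_gt 0 (c i) with h | h
    · exact (neg_nonpos.2 (abs_nonneg _)).trans (mul_nonneg h (Real.exp_pos _).le)
    · rw [abs_of_neg h, neg_neg]
      have : Real.exp (c i * t) ≤ 1 :=
        Real.exp_le_one_iff.2 (mul_nonpos_of_nonpos_of_nonneg h.le ht)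
      nlinarith
  have hmain : B ≤ a j * (c j * Real.exp (c j * t)) := by
    have hBt : B = a j * (c j * (c j * t)) := by
      rw [ht_def]
      field_simp
    have hexp : c j * t ≤ Real.exp (c j * t) := by
      linarith [Real.add_one_le_exp (c j * t)]
    calc B = a j * (c j * (c j * t)) := hBt
      _ ≤ a j * (c j * Real.exp (c j * t)) := by gcongr
  linarith

theorem strictMono_mul_exp {c : ℝ} (hc : c ≠ 0) :
    StrictMono fun t : ℝ => c * Real.exp (c * t) := by
  intro x y hxy
  rcases hc.lt_or_gt with h | h
  · exact mul_lt_mul_of_neg_left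
      (Real.exp_lt_exp.2 (mul_lt_mul_of_neg_left hxy h)) h
  · exact mul_lt_mul_of_pos_left
      (Real.exp_lt_exp.2 (mul_lt_mul_of_pos_left hxy h)) h

theorem strictMono_sum_mul_exp (ha : ∀ i ∈ s, 0 ≤ a i)
    (hpos : ∃ i ∈ s, 0 < c i ∧ 0 < a i) :
    StrictMono fun t : ℝ => ∑ i ∈ s, a i * (c i * Real.exp (c i * t)) := by
  intro x y hxy
  obtain ⟨j, hj, hcj, haj⟩ := hpos
  refine Finset.sum_lt_sum (fun i hi => ?_)
    ⟨j, hj, mul_lt_mul_of_pos_left (strictMono_mul_exp hcj.ne' hxy) haj⟩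
  refine mul_le_mul_of_nonneg_left ?_ (ha i hi)
  by_cases h : c i = 0
  · simp [h]
  · exact (strictMono_mul_exp h hxy).le

theorem existsUnique_sum_mul_exp_eq_zero (ha : ∀ i ∈ s, 0 ≤ a i)
    (hneg : ∃ i ∈ s, c i < 0 ∧ 0 < a i) (hpos : ∃ i ∈ s, 0 < c i ∧ 0 < a i) :
    ∃! t : ℝ, ∑ i ∈ s, a i * (c i * Real.exp (c i * t)) = 0 := by
  obtain ⟨t₁, ht₁⟩ := exists_sum_mul_exp_nonneg ha hpos
  obtain ⟨t₂, ht₂⟩ := exists_sum_mul_exp_nonneg (c := fun i => -c i) ha (by simpa using hneg)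
  have hcont : Continuous fun t : ℝ => ∑ i ∈ s, a i * (c i * Real.exp (c i * t)) := by
    fun_prop
  obtain ⟨t, ht⟩ := mem_range_of_exists_le_of_exists_ge hcont (c := 0)
    ⟨-t₂, by simpa using ht₂⟩ ⟨t₁, ht₁⟩
  exact ⟨t, ht, fun t' ht' =>
    (strictMono_sum_mul_exp ha hpos).injective (ht'.trans ht.symm)⟩

end ExponentialSum

theorem norm_sq_mul_rpow_half_smul {E : Type*} [NormedAddCommGroup E] [NormedSpace ℝ E]
    {r : ℝ} (hr : 0 < r) (σ x : ℝ) (v : E) :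
    ‖(σ * r ^ (x / 2)) • v‖ ^ 2 = σ ^ 2 * (‖v‖ ^ 2 * Real.exp (x * Real.log r)) := by
  have h : (r ^ (x / 2)) ^ 2 = Real.exp (x * Real.log r) := by
    rw [Real.rpow_def_of_pos hr, ← Real.exp_nat_mul]
    congr 1
    push_cast
    ring
  rw [norm_smul, mul_pow, Real.norm_eq_abs, sq_abs, mul_pow, h]
  ring

theorem sum_mul_sub_mul_exp {ι : Type*} (s : Finset ι) (a x : ι → ℝ) (M t : ℝ) :
    ∑ i ∈ s, a i * ((x i - M) * Real.exp ((x i - M) * t)) =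
      Real.exp (-(M * t)) * (∑ i ∈ s, x i * (a i * Real.exp (x i * t)) -
        M * ∑ i ∈ s, a i * Real.exp (x i * t)) := by
  rw [Finset.mul_sum, ← Finset.sum_sub_distrib, Finset.mul_sum]
  refine Finset.sum_congr rfl fun i _ => ?_
  rw [show (x i - M) * t = -(M * t) + x i * t by ring, Real.exp_add]
  ring

/-- For every `w ∈ Ω` there exists a unique pair of positive reals
`(σ₀, r)` such that the vector `u` with blocks `u_l = σ₀·r^{l/2}·w_l`
(`l = F, …, −F`) belongs to `𝓜`. -/
theorem spinF_orthogonal_retraction_unique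
    (F n : ℕ) (hF : 1 ≤ F) (hn : 1 ≤ n) (M : ℝ)
    (hM0 : 0 ≤ M) (hMF : M < (F : ℝ))
    (w : ℤ → EuclideanSpace ℝ (Fin (2 * n)))
    (hsupp : ∀ l : ℤ, l ∉ Finset.Icc (-(F : ℤ)) (F : ℤ) → w l = 0)
    -- `w ∈ Ω`
    (hΩ1 : ∃ l : ℤ, (l : ℝ) < M ∧ w l ≠ 0)
    (hΩ2 : ∃ l : ℤ, M < (l : ℝ) ∧ w l ≠ 0) :
    ∃! p : ℝ × ℝ, (0 < p.1 ∧ 0 < p.2) ∧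
      (∑ l ∈ Finset.Icc (-(F : ℤ)) (F : ℤ),
        ‖(p.1 * p.2 ^ ((l : ℝ) / 2)) • w l‖ ^ 2 = 1) ∧
      (∑ l ∈ Finset.Icc (-(F : ℤ)) (F : ℤ),
        (l : ℝ) * ‖(p.1 * p.2 ^ ((l : ℝ) / 2)) • w l‖ ^ 2 = M) := by
  have hmem : ∀ l : ℤ, w l ≠ 0 → l ∈ Finset.Icc (-(F : ℤ)) (F : ℤ) := fun l hl =>
    not_imp_comm.1 (hsupp l) hl
  obtain ⟨l₁, hl₁, hw₁⟩ := hΩ1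
  obtain ⟨l₂, hl₂, hw₂⟩ := hΩ2
  set s : Finset ℤ := Finset.Icc (-(F : ℤ)) (F : ℤ)
  obtain ⟨t, ht, huniq⟩ := existsUnique_sum_mul_exp_eq_zero (s := s)
    (a := fun l => ‖w l‖ ^ 2) (c := fun l => (l : ℝ) - M) (fun l _ => by positivity)
    ⟨l₁, hmem l₁ hw₁, sub_neg.2 hl₁, by positivity⟩
    ⟨l₂, hmem l₂ hw₂, sub_pos.2 hl₂, by positivity⟩
  simp only [sum_mul_sub_mul_exp, mul_eq_zero, Real.exp_ne_zero, false_or] at ht huniq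
  have hS : 0 < ∑ l ∈ s, ‖w l‖ ^ 2 * Real.exp ((l : ℝ) * t) :=
    Finset.sum_pos' (fun l _ => by positivity) ⟨l₁, hmem l₁ hw₁, by positivity⟩
  have hsum : ∀ σ r : ℝ, 0 < r →
      ∑ l ∈ s, ‖(σ * r ^ ((l : ℝ) / 2)) • w l‖ ^ 2 =
        σ ^ 2 * ∑ l ∈ s, ‖w l‖ ^ 2 * Real.exp ((l : ℝ) * Real.log r) := fun σ r hr => by
    simp only [norm_sq_mul_rpow_half_smul hr, Finset.mul_sum]
  have hsum_mul : ∀ σ r : ℝ, 0 < r →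
      ∑ l ∈ s, (l : ℝ) * ‖(σ * r ^ ((l : ℝ) / 2)) • w l‖ ^ 2 =
        σ ^ 2 * ∑ l ∈ s, (l : ℝ) * (‖w l‖ ^ 2 * Real.exp ((l : ℝ) * Real.log r)) :=
    fun σ r hr => by
      simp only [norm_sq_mul_rpow_half_smul hr, Finset.mul_sum, mul_left_comm (σ ^ 2)]
  set S : ℝ := ∑ l ∈ s, ‖w l‖ ^ 2 * Real.exp ((l : ℝ) * t)
  refine ⟨((√S)⁻¹, Real.exp t), ⟨⟨by positivity, Real.exp_pos t⟩, ?_, ?_⟩, ?_⟩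
  · rw [hsum _ _ (Real.exp_pos t), Real.log_exp, inv_pow, Real.sq_sqrt hS.le]
    exact inv_mul_cancel₀ hS.ne'
  · rw [hsum_mul _ _ (Real.exp_pos t), Real.log_exp, inv_pow, Real.sq_sqrt hS.le,
      sub_eq_zero.1 ht, mul_left_comm, inv_mul_cancel₀ hS.ne', mul_one]
  · rintro ⟨σ, r⟩ ⟨⟨hσ, hr⟩, h₁, h₂⟩
    dsimp only at hσ hr h₁ h₂
    rw [hsum σ r hr] at h₁
    rw [hsum_mul σ r hr] at h₂
    have hlog : Real.log r = t := by
      refine huniq _ (mul_left_cancel₀ (pow_ne_zero 2 hσ.ne') ?_)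
      rw [mul_sub, h₂, mul_left_comm, h₁, mul_one, sub_self, mul_zero]
    rw [hlog] at h₁
    refine Prod.ext ?_ ?_
    · change σ = (√S)⁻¹
      rw [← Real.sqrt_inv, ← eq_inv_of_mul_eq_one_left h₁, Real.sqrt_sq hσ.le]
    · change r = Real.exp t
      rw [← hlog, Real.exp_log hr]
end

section
/- Let w ∈ S. Then the denominator D := (wᵀw)·(wᵀΓ²w) − (wᵀΓw)² is positive, the quantity wᵀΓ²w − (M + l)·wᵀΓw + M·l·wᵀw is positive for every l = F, …, −F, and the vector z defined blockwise by z_l = √((wᵀΓ²w − (M + l)·wᵀΓw + M·l·wᵀw)/D)·w_l satisfies zᵀz = 1 and zᵀΓz = M, i.e. z ∈ 𝓜. -/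
open scoped RealInnerProductSpace

/-- A real affine function that is positive at `F` and `-F` is positive on `[-F, F]`. -/
lemma affine_pos_of_pos_endpoints {a b x F : ℝ} (h₁ : 0 < a + b * F) (h₂ : 0 < a + b * -F)
    (hx₁ : -F ≤ x) (hx₂ : x ≤ F) : 0 < a + b * x := by
  rcases le_total 0 b with hb | hb
  · linarith [mul_le_mul_of_nonneg_left hx₁ hb]
  · linarith [mul_le_mul_of_nonpos_left hx₂ hb]

/-- Weighted sums of the affine weights `C - (M + l) B + M l A` in terms of the moments. -/
lemma sum_mul_affine_weight (s : Finset ℤ) (f g : ℤ → ℝ) (M A B C : ℝ) :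
    ∑ l ∈ s, g l * ((C - (M + (l : ℝ)) * B + M * (l : ℝ) * A) * f l) =
      (C - M * B) * ∑ l ∈ s, g l * f l + (M * A - B) * ∑ l ∈ s, g l * ((l : ℝ) * f l) := by
  rw [Finset.mul_sum, Finset.mul_sum, ← Finset.sum_add_distrib]
  exact Finset.sum_congr rfl fun l _ => by ring

/-- For `w ∈ S`, the denominator `D = (wᵀw)(wᵀΓ²w) − (wᵀΓw)²` is
positive, `wᵀΓ²w − (M+l)·wᵀΓw + M·l·wᵀw > 0` for every `l = F, …, −F`, and the
vector `z` with `z_l = √((wᵀΓ²w − (M+l)·wᵀΓw + M·l·wᵀw)/D)·w_l` belongs to `𝓜`. -/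
theorem spinF_closed_form_retraction_in_M
    (F n : ℕ) (hF : 1 ≤ F) (hn : 1 ≤ n) (M : ℝ)
    (hM0 : 0 ≤ M) (hMF : M < (F : ℝ))
    (w : ℤ → EuclideanSpace ℝ (Fin (2 * n)))
    (hsupp : ∀ l : ℤ, l ∉ Finset.Icc (-(F : ℤ)) (F : ℤ) → w l = 0)
    (A B C : ℝ)
    (hA : A = ∑ l ∈ Finset.Icc (-(F : ℤ)) (F : ℤ), ‖w l‖ ^ 2)
    (hB : B = ∑ l ∈ Finset.Icc (-(F : ℤ)) (F : ℤ), (l : ℝ) * ‖w l‖ ^ 2)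
    (hC : C = ∑ l ∈ Finset.Icc (-(F : ℤ)) (F : ℤ), (l : ℝ) ^ 2 * ‖w l‖ ^ 2)
    -- `w ∈ S`
    (hS1 : 0 < C - (M + (F : ℝ)) * B + M * (F : ℝ) * A)
    (hS2 : 0 < C - (M - (F : ℝ)) * B + M * (-(F : ℝ)) * A)
    (z : ℤ → EuclideanSpace ℝ (Fin (2 * n)))
    (hz : ∀ l : ℤ, z l = Real.sqrt ((C - (M + (l : ℝ)) * B + M * (l : ℝ) * A)
        / (A * C - B ^ 2)) • w l) :
    0 < A * C - B ^ 2 ∧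
    (∀ l ∈ Finset.Icc (-(F : ℤ)) (F : ℤ),
      0 < C - (M + (l : ℝ)) * B + M * (l : ℝ) * A) ∧
    (∑ l ∈ Finset.Icc (-(F : ℤ)) (F : ℤ), ‖z l‖ ^ 2 = 1) ∧
    (∑ l ∈ Finset.Icc (-(F : ℤ)) (F : ℤ), (l : ℝ) * ‖z l‖ ^ 2 = M) := by
  have hpos : ∀ l ∈ Finset.Icc (-(F : ℤ)) (F : ℤ),
      0 < C - (M + (l : ℝ)) * B + M * (l : ℝ) * A := by
    intro l hl
    obtain ⟨hl₁, hl₂⟩ := Finset.mem_Icc.1 hl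
    have h := affine_pos_of_pos_endpoints (a := C - M * B) (b := M * A - B) (x := l) (F := F)
      (by linarith) (by linarith) (by exact_mod_cast hl₁) (by exact_mod_cast hl₂)
    linarith
  have hsum₀ : ∑ l ∈ Finset.Icc (-(F : ℤ)) (F : ℤ),
      (C - (M + (l : ℝ)) * B + M * (l : ℝ) * A) * ‖w l‖ ^ 2 = A * C - B ^ 2 := by
    have h := sum_mul_affine_weight (Finset.Icc (-(F : ℤ)) (F : ℤ))
      (fun l => ‖w l‖ ^ 2) (fun _ => 1) M A B C
    simp only [one_mul] at h
    rw [h, ← hA, ← hB]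
    ring
  have hsum₁ : ∑ l ∈ Finset.Icc (-(F : ℤ)) (F : ℤ),
      (l : ℝ) * ((C - (M + (l : ℝ)) * B + M * (l : ℝ) * A) * ‖w l‖ ^ 2) =
        M * (A * C - B ^ 2) := by
    have h := sum_mul_affine_weight (Finset.Icc (-(F : ℤ)) (F : ℤ))
      (fun l => ‖w l‖ ^ 2) (fun l => (l : ℝ)) M A B C
    simp only [← mul_assoc, ← sq] at h hC ⊢
    rw [h, ← hB, ← hC]
    ring
  have hD : 0 < A * C - B ^ 2 := by
    rw [← hsum₀]
    refine Finset.sum_pos' (fun l hl => mul_nonneg (hpos l hl).le (sq_nonneg _)) ?_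
    by_contra! hcon
    have hw : ∀ l ∈ Finset.Icc (-(F : ℤ)) (F : ℤ), ‖w l‖ ^ 2 = 0 := fun l hl =>
      le_antisymm (nonpos_of_mul_nonpos_right (hcon l hl) (hpos l hl)) (sq_nonneg _)
    have hA₀ : A = 0 := hA.trans (Finset.sum_eq_zero hw)
    have hB₀ : B = 0 := hB.trans (Finset.sum_eq_zero fun l hl => by rw [hw l hl, mul_zero])
    have hC₀ : C = 0 := hC.trans (Finset.sum_eq_zero fun l hl => by rw [hw l hl, mul_zero])
    simp [hA₀, hB₀, hC₀] at hS1
  have hnorm : ∀ l ∈ Finset.Icc (-(F : ℤ)) (F : ℤ), ‖z l‖ ^ 2 =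
      (C - (M + (l : ℝ)) * B + M * (l : ℝ) * A) * ‖w l‖ ^ 2 / (A * C - B ^ 2) := by
    intro l hl
    rw [hz, norm_smul, mul_pow, Real.norm_eq_abs, sq_abs,
      Real.sq_sqrt (div_nonneg (hpos l hl).le hD.le), div_mul_eq_mul_div]
  refine ⟨hD, hpos, ?_, ?_⟩
  · rw [Finset.sum_congr rfl hnorm, ← Finset.sum_div, hsum₀, div_self hD.ne']
  · rw [Finset.sum_congr rfl fun l hl => by rw [hnorm l hl, ← mul_div_assoc],
      ← Finset.sum_div, hsum₁, mul_div_cancel_right₀ _ hD.ne']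
end

section
/- For every w ∈ S there exists a unique pair (μ, λ) ∈ ℝ² with 1 + 2μ + 2Fλ > 0 and 1 + 2μ − 2Fλ > 0 such that the vector z defined blockwise by z_l = √(1 + 2μ + 2l·λ)·w_l belongs to 𝓜; moreover this pair is given explicitly by μ = (wᵀΓ²w − M·wᵀΓw)/(2((wᵀw)(wᵀΓ²w) − (wᵀΓw)²)) − 1/2 and λ = (M·wᵀw − wᵀΓw)/(2((wᵀw)(wᵀΓ²w) − (wᵀΓw)²)). -/
open scoped RealInnerProductSpace

/-- Weighted Cauchy–Schwarz for the first three moments of a nonnegative weight. -/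
lemma sq_sum_mul_le_sum_mul_sum_sq {ι : Type*} (s : Finset ι) (x a : ι → ℝ)
    (ha : ∀ i ∈ s, 0 ≤ a i) :
    (∑ i ∈ s, x i * a i) ^ 2 ≤ (∑ i ∈ s, a i) * ∑ i ∈ s, x i ^ 2 * a i :=
  Finset.sum_sq_le_sum_mul_sum_of_sq_le_mul s ha
    (fun i hi => mul_nonneg (sq_nonneg _) (ha i hi)) (fun i _ => le_of_eq (by ring))

/-- The Gram determinant is positive when the moments `A`, `B`, `C` satisfy the two inequalities
defining `S`. -/
lemma gram_det_pos {A B C M f : ℝ} (hA : 0 ≤ A) (hBu : B ≤ f * A) (hBl : -(f * A) ≤ B)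
    (hC : C ≤ f ^ 2 * A) (hCS : B ^ 2 ≤ A * C)
    (hS1 : 0 < C - (M + f) * B + M * f * A)
    (hS2 : 0 < C - (M - f) * B + M * (-f) * A) :
    0 < A * C - B ^ 2 := by
  have hApos : 0 < A := by
    refine hA.lt_of_ne fun h => ?_
    subst h
    have hB : B = 0 := by linarith
    subst hB
    linarith
  refine (sub_nonneg.2 hCS).lt_of_ne fun h => ?_
  have h1 : 0 < (f * A - B) * (M * A - B) := by
    have := mul_pos hApos hS1
    linear_combination this - h
  have h2 : 0 < (B + f * A) * (B - M * A) := by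
    have := mul_pos hApos hS2
    linear_combination this - h
  have h3 := pos_of_mul_pos_right h1 (by linarith)
  have h4 := pos_of_mul_pos_right h2 (by linarith)
  linarith

lemma affine_pos_of_abs_le {f a b x : ℝ} (h1 : 0 < a + f * b) (h2 : 0 < a - f * b)
    (hl : -f ≤ x) (hu : x ≤ f) : 0 < a + x * b := by
  rcases le_total 0 b with hb | hb <;> nlinarith

lemma norm_sqrt_smul_sq {E : Type*} [NormedAddCommGroup E] [NormedSpace ℝ E] {c : ℝ}
    (hc : 0 ≤ c) (v : E) : ‖√c • v‖ ^ 2 = c * ‖v‖ ^ 2 := by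
  rw [norm_smul, mul_pow, Real.norm_eq_abs, sq_abs, Real.sq_sqrt hc]

/-- For every `w ∈ S` there is a unique pair `(μ, λ) ∈ ℝ²` with
`1 + 2μ ± 2Fλ > 0` such that the vector `z` with blocks
`z_l = √(1 + 2μ + 2l·λ)·w_l` belongs to `𝓜`; moreover this pair is given by
`μ = (wᵀΓ²w − M·wᵀΓw)/(2((wᵀw)(wᵀΓ²w) − (wᵀΓw)²)) − 1/2` and
`λ = (M·wᵀw − wᵀΓw)/(2((wᵀw)(wᵀΓ²w) − (wᵀΓw)²))`. -/
theorem spinF_closed_form_retraction_unique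
    (F n : ℕ) (hF : 1 ≤ F) (hn : 1 ≤ n) (M : ℝ)
    (hM0 : 0 ≤ M) (hMF : M < (F : ℝ))
    (w : ℤ → EuclideanSpace ℝ (Fin (2 * n)))
    (hsupp : ∀ l : ℤ, l ∉ Finset.Icc (-(F : ℤ)) (F : ℤ) → w l = 0)
    (A B C : ℝ)
    (hA : A = ∑ l ∈ Finset.Icc (-(F : ℤ)) (F : ℤ), ‖w l‖ ^ 2)
    (hB : B = ∑ l ∈ Finset.Icc (-(F : ℤ)) (F : ℤ), (l : ℝ) * ‖w l‖ ^ 2)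
    (hC : C = ∑ l ∈ Finset.Icc (-(F : ℤ)) (F : ℤ), (l : ℝ) ^ 2 * ‖w l‖ ^ 2)
    -- `w ∈ S`
    (hS1 : 0 < C - (M + (F : ℝ)) * B + M * (F : ℝ) * A)
    (hS2 : 0 < C - (M - (F : ℝ)) * B + M * (-(F : ℝ)) * A)
    -- the explicit pair
    (μ₀ lam₀ : ℝ)
    (hμ₀ : μ₀ = (C - M * B) / (2 * (A * C - B ^ 2)) - 1 / 2)
    (hlam₀ : lam₀ = (M * A - B) / (2 * (A * C - B ^ 2))) :
    (∃! p : ℝ × ℝ,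
      (0 < 1 + 2 * p.1 + 2 * (F : ℝ) * p.2 ∧ 0 < 1 + 2 * p.1 - 2 * (F : ℝ) * p.2) ∧
      (∑ l ∈ Finset.Icc (-(F : ℤ)) (F : ℤ),
        ‖Real.sqrt (1 + 2 * p.1 + 2 * (l : ℝ) * p.2) • w l‖ ^ 2 = 1) ∧
      (∑ l ∈ Finset.Icc (-(F : ℤ)) (F : ℤ),
        (l : ℝ) * ‖Real.sqrt (1 + 2 * p.1 + 2 * (l : ℝ) * p.2) • w l‖ ^ 2 = M)) ∧
    ((0 < 1 + 2 * μ₀ + 2 * (F : ℝ) * lam₀ ∧ 0 < 1 + 2 * μ₀ - 2 * (F : ℝ) * lam₀) ∧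
      (∑ l ∈ Finset.Icc (-(F : ℤ)) (F : ℤ),
        ‖Real.sqrt (1 + 2 * μ₀ + 2 * (l : ℝ) * lam₀) • w l‖ ^ 2 = 1) ∧
      (∑ l ∈ Finset.Icc (-(F : ℤ)) (F : ℤ),
        (l : ℝ) * ‖Real.sqrt (1 + 2 * μ₀ + 2 * (l : ℝ) * lam₀) • w l‖ ^ 2 = M)) := by
  have hbd : ∀ l ∈ Finset.Icc (-(F : ℤ)) (F : ℤ), -(F : ℝ) ≤ l ∧ (l : ℝ) ≤ F := by
    intro l hl
    rw [Finset.mem_Icc] at hl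
    exact ⟨by exact_mod_cast hl.1, by exact_mod_cast hl.2⟩
  have hD : 0 < A * C - B ^ 2 := by
    refine gram_det_pos (f := F) ?_ ?_ ?_ ?_ ?_ hS1 hS2
    · rw [hA]; positivity
    · rw [hA, hB, Finset.mul_sum]
      exact Finset.sum_le_sum fun l hl => mul_le_mul_of_nonneg_right (hbd l hl).2 (sq_nonneg _)
    · rw [hA, hB, ← neg_mul, Finset.mul_sum]
      exact Finset.sum_le_sum fun l hl => mul_le_mul_of_nonneg_right (hbd l hl).1 (sq_nonneg _)
    · rw [hA, hC, Finset.mul_sum]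
      exact Finset.sum_le_sum fun l hl => mul_le_mul_of_nonneg_right
        (sq_le_sq' (hbd l hl).1 (hbd l hl).2) (sq_nonneg _)
    · rw [hA, hB, hC]
      exact sq_sum_mul_le_sum_mul_sum_sq _ _ _ fun _ _ => sq_nonneg _
  have hnorm : ∀ m k : ℝ, 0 < 1 + 2 * m + 2 * (F : ℝ) * k → 0 < 1 + 2 * m - 2 * (F : ℝ) * k →
      ∀ l ∈ Finset.Icc (-(F : ℤ)) (F : ℤ), ‖Real.sqrt (1 + 2 * m + 2 * (l : ℝ) * k) • w l‖ ^ 2 =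
        (1 + 2 * m + 2 * (l : ℝ) * k) * ‖w l‖ ^ 2 := by
    intro m k h1 h2 l hl
    have := affine_pos_of_abs_le (f := F) (a := 1 + 2 * m) (b := 2 * k) (x := l)
      (by linarith) (by linarith) (hbd l hl).1 (hbd l hl).2
    exact norm_sqrt_smul_sq (by linarith) _
  have hsum0 : ∀ m k : ℝ, 0 < 1 + 2 * m + 2 * (F : ℝ) * k → 0 < 1 + 2 * m - 2 * (F : ℝ) * k →
      ∑ l ∈ Finset.Icc (-(F : ℤ)) (F : ℤ), ‖Real.sqrt (1 + 2 * m + 2 * (l : ℝ) * k) • w l‖ ^ 2 =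
        (1 + 2 * m) * A + 2 * k * B := by
    intro m k h1 h2
    rw [hA, hB, Finset.mul_sum, Finset.mul_sum, ← Finset.sum_add_distrib]
    refine Finset.sum_congr rfl fun l hl => ?_
    rw [hnorm m k h1 h2 l hl]
    ring
  have hsum1 : ∀ m k : ℝ, 0 < 1 + 2 * m + 2 * (F : ℝ) * k → 0 < 1 + 2 * m - 2 * (F : ℝ) * k →
      ∑ l ∈ Finset.Icc (-(F : ℤ)) (F : ℤ),
        (l : ℝ) * ‖Real.sqrt (1 + 2 * m + 2 * (l : ℝ) * k) • w l‖ ^ 2 =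
        (1 + 2 * m) * B + 2 * k * C := by
    intro m k h1 h2
    rw [hB, hC, Finset.mul_sum, Finset.mul_sum, ← Finset.sum_add_distrib]
    refine Finset.sum_congr rfl fun l hl => ?_
    rw [hnorm m k h1 h2 l hl]
    ring
  have hD' : A * C - B ^ 2 ≠ 0 := hD.ne'
  have hμ : 1 + 2 * μ₀ = (C - M * B) / (A * C - B ^ 2) := by
    rw [hμ₀]; field_simp; ring
  have hlam : 2 * lam₀ = (M * A - B) / (A * C - B ^ 2) := by
    rw [hlam₀]; field_simp
  have hpos1 : 0 < 1 + 2 * μ₀ + 2 * (F : ℝ) * lam₀ := by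
    have : 1 + 2 * μ₀ + 2 * (F : ℝ) * lam₀ =
        (C - (M + (F : ℝ)) * B + M * (F : ℝ) * A) / (A * C - B ^ 2) := by
      rw [mul_right_comm, hμ, hlam]; ring
    rw [this]
    exact div_pos hS1 hD
  have hpos2 : 0 < 1 + 2 * μ₀ - 2 * (F : ℝ) * lam₀ := by
    have : 1 + 2 * μ₀ - 2 * (F : ℝ) * lam₀ =
        (C - (M - (F : ℝ)) * B + M * (-(F : ℝ)) * A) / (A * C - B ^ 2) := by
      rw [mul_right_comm, hμ, hlam]; ring
    rw [this]
    exact div_pos hS2 hD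
  have hsol : (1 + 2 * μ₀) * A + 2 * lam₀ * B = 1 ∧ (1 + 2 * μ₀) * B + 2 * lam₀ * C = M := by
    rw [hμ, hlam]
    constructor <;> rw [div_mul_eq_mul_div, div_mul_eq_mul_div, ← add_div, div_eq_iff hD'] <;> ring
  refine ⟨⟨(μ₀, lam₀), ⟨⟨hpos1, hpos2⟩, ?_, ?_⟩, ?_⟩, ⟨hpos1, hpos2⟩, ?_, ?_⟩
  · exact (hsum0 _ _ hpos1 hpos2).trans hsol.1
  · exact (hsum1 _ _ hpos1 hpos2).trans hsol.2
  · rintro ⟨m, k⟩ ⟨⟨h1, h2⟩, h3, h4⟩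
    dsimp only at h1 h2 h3 h4
    rw [hsum0 m k h1 h2] at h3
    rw [hsum1 m k h1 h2] at h4
    have hm : 1 + 2 * m = (C - M * B) / (A * C - B ^ 2) := by
      rw [eq_div_iff hD']
      linear_combination C * h3 - B * h4
    have hk : 2 * k = (M * A - B) / (A * C - B ^ 2) := by
      rw [eq_div_iff hD']
      linear_combination A * h4 - B * h3
    ext
    · change m = μ₀
      linarith
    · change k = lam₀
      linarith
  · exact (hsum0 _ _ hpos1 hpos2).trans hsol.1
  · exact (hsum1 _ _ hpos1 hpos2).trans hsol.2
end
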